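/- The function F⁺ = Fc + Fs satisfies 1.91 < F⁺(x) < 3.37 for all x ≥ 3π/4, and 0 ≤ F⁺(x) < 3.37 for 0 ≤ x < 3π/4; moreover x = 3π/4 is the global maximum point of F⁺ on (0, ∞) and x = 7π/4 is its smallest local minimum, i.e. F⁺(x) ≤ F⁺(3π/4) for all x > 0 and F⁺(x) ≥ F⁺(7π/4) for all x ≥ 3π/4. -/

import Mathlib

open Real MeasureTheory Set
open scoped Classical

noncomputable section

/-- A window function `g ∈ 𝒲`: nonnegative, even, with support `(-2/3, 2/3)`,
and whose integer translates form a partition of unity. -/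
structure IsWindow (g : ℝ → ℝ) : Prop where
  nonneg : ∀ x, 0 ≤ g x
  even_fun : ∀ x, g (-x) = g x
  supp_eq : Function.support g = Ioo (-(2/3) : ℝ) (2/3)
  partition : ∀ x : ℝ, HasSum (fun z : ℤ => g (x + (z : ℝ))) 1

/-- `g ∈ 𝒲^q`: a window function that is `q`-times continuously differentiable. -/
def IsWindowQ (g : ℝ → ℝ) (q : ℕ) : Prop := IsWindow g ∧ ContDiff ℝ q g

/-- `g̃(x) = g(x/2) - g(x)`. -/
def gtilde (g : ℝ → ℝ) : ℝ → ℝ := fun x => g (x / 2) - g x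

/-- Horizontal bivariate window `Ψ^{(h)}(x) = g̃(x₁) g(x₂)`. -/
def PsiH (g : ℝ → ℝ) : ℝ × ℝ → ℝ := fun x => gtilde g x.1 * g x.2

/-- Vertical bivariate window `Ψ^{(v)}(x) = g(x₁) g̃(x₂)`. -/
def PsiV (g : ℝ → ℝ) : ℝ × ℝ → ℝ := fun x => g x.1 * gtilde g x.2

/-- `Ψ_{j,ℓ}^{(i)}(ξ) = Ψ^{(i)}((N_{j,ℓ}^{(i)})^{-T} ξ)`, where the inverse transpose of the
shear matrices has been written out explicitly.  `i = true` is the horizontal case `(h)`,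
`i = false` the vertical case `(v)`. -/
def PsiJL (g : ℝ → ℝ) (i : Bool) (j : ℕ) (ℓ : ℤ) : ℝ × ℝ → ℝ := fun ξ =>
  if i then
    PsiH g ((2:ℝ) ^ (-(j:ℝ)) * ξ.1,
            (2:ℝ) ^ (-(j:ℝ)/2) * ξ.2 - (ℓ:ℝ) * (2:ℝ) ^ (-(j:ℝ)) * ξ.1)
  else
    PsiV g ((2:ℝ) ^ (-(j:ℝ)/2) * ξ.1 - (ℓ:ℝ) * (2:ℝ) ^ (-(j:ℝ)) * ξ.2,
            (2:ℝ) ^ (-(j:ℝ)) * ξ.2)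

/-- Discrete angles `θ_{j,ℓ}^{(h)} = arctan(ℓ 2^{-j/2})`,
`θ_{j,ℓ}^{(v)} = arccot(ℓ 2^{-j/2}) = π/2 - arctan(ℓ 2^{-j/2})`. -/
def thetaJL (i : Bool) (j : ℕ) (ℓ : ℤ) : ℝ :=
  if i then arctan ((ℓ:ℝ) * (2:ℝ) ^ (-(j:ℝ)/2))
  else π/2 - arctan ((ℓ:ℝ) * (2:ℝ) ^ (-(j:ℝ)/2))

/-- The pattern `𝒫(N_{j,ℓ}^{(i)}) = (N_{j,ℓ}^{(i)})^{-1} ℤ² ∩ [-1/2,1/2)²`: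
`y` belongs to the pattern iff `N_{j,ℓ}^{(i)} y ∈ ℤ²` and `y ∈ [-1/2,1/2)²`. -/
def pattern (i : Bool) (j : ℕ) (ℓ : ℤ) : Set (ℝ × ℝ) :=
  {y : ℝ × ℝ |
    (∃ k : ℤ × ℤ,
      (if i then ((2:ℝ)^(j:ℝ) * y.1 + (ℓ:ℝ) * (2:ℝ)^((j:ℝ)/2) * y.2, (2:ℝ)^((j:ℝ)/2) * y.2)
       else ((2:ℝ)^((j:ℝ)/2) * y.1, (ℓ:ℝ) * (2:ℝ)^((j:ℝ)/2) * y.1 + (2:ℝ)^(j:ℝ) * y.2))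
        = ((k.1 : ℝ), (k.2 : ℝ)))
    ∧ y.1 ∈ Ico (-(1/2) : ℝ) (1/2) ∧ y.2 ∈ Ico (-(1/2) : ℝ) (1/2)}

/-- `ỹ = y - (2^{-j-1},0)ᵀ` in the horizontal case, `ỹ = y - (0,2^{-j-1})ᵀ` in the vertical one. -/
def ytilde (i : Bool) (j : ℕ) (y : ℝ × ℝ) : ℝ × ℝ :=
  if i then (y.1 - (2:ℝ) ^ (-(j:ℝ) - 1), y.2) else (y.1, y.2 - (2:ℝ) ^ (-(j:ℝ) - 1))

/-- The trigonometric polynomial shearlet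
`ψ_{j,ℓ,y}^{(i)}(x) = ∑_{k∈ℤ²} Ψ_{j,ℓ}^{(i)}(k) e^{i k·(x - 2πỹ)}`. -/
def shearlet (g : ℝ → ℝ) (i : Bool) (j : ℕ) (ℓ : ℤ) (y : ℝ × ℝ) : ℝ × ℝ → ℂ := fun x =>
  ∑' k : ℤ × ℤ, (PsiJL g i j ℓ ((k.1 : ℝ), (k.2 : ℝ)) : ℂ) *
    Complex.exp (Complex.I *
      (((k.1 : ℝ) * (x.1 - 2*π*(ytilde i j y).1)
        + (k.2 : ℝ) * (x.2 - 2*π*(ytilde i j y).2) : ℝ) : ℂ))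

/-- `⟨f,h⟩₂ = (2π)^{-2} ∫_{𝕋²} f(x) conj(h(x)) dx`, with the torus realised as `[-π,π]²`. -/
def inner2 (f h : ℝ × ℝ → ℂ) : ℂ :=
  ((2*π)^2 : ℂ)⁻¹ * ∫ x in (Icc (-π) π ×ˢ Icc (-π) π : Set (ℝ × ℝ)), f x * (starRingEnd ℂ) (h x)

/-- The `2π`-periodization `f^{2π} = ∑_{n∈ℤ²} f(· + 2πn)`. -/
def periodize (f : ℝ × ℝ → ℝ) : ℝ × ℝ → ℝ := fun x =>
  ∑' n : ℤ × ℤ, f (x.1 + 2*π*(n.1 : ℝ), x.2 + 2*π*(n.2 : ℝ))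

/-- Euclidean norm `|x|₂` on `ℝ²`. -/
def nrm2 (x : ℝ × ℝ) : ℝ := Real.sqrt (x.1^2 + x.2^2)

/-- First partial derivative of a complex-valued function of two real variables. -/
def pd1 (f : ℝ × ℝ → ℂ) : ℝ × ℝ → ℂ := fun x => deriv (fun t => f (t, x.2)) x.1

/-- Second partial derivative of a complex-valued function of two real variables. -/
def pd2 (f : ℝ × ℝ → ℂ) : ℝ × ℝ → ℂ := fun x => deriv (fun t => f (x.1, t)) x.2

/-- `∂^r = ∂^{r₁+r₂}/∂x₁^{r₁}∂x₂^{r₂}` (complex-valued). -/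
def pd (r : ℕ × ℕ) (f : ℝ × ℝ → ℂ) : ℝ × ℝ → ℂ := pd1^[r.1] (pd2^[r.2] f)

/-- First partial derivative of a real-valued function of two real variables. -/
def pdR1 (f : ℝ × ℝ → ℝ) : ℝ × ℝ → ℝ := fun x => deriv (fun t => f (t, x.2)) x.1

/-- Second partial derivative of a real-valued function of two real variables. -/
def pdR2 (f : ℝ × ℝ → ℝ) : ℝ × ℝ → ℝ := fun x => deriv (fun t => f (x.1, t)) x.2

/-- `∂^r = ∂^{r₁+r₂}/∂x₁^{r₁}∂x₂^{r₂}` (real-valued). -/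
def pdR (r : ℕ × ℕ) (f : ℝ × ℝ → ℝ) : ℝ × ℝ → ℝ := pdR1^[r.1] (pdR2^[r.2] f)

/-- The Fourier transform `𝓕f(x) = (2π)^{-2} ∫_{ℝ²} f(ξ) e^{-iξ·x} dξ`. -/
def FT (f : ℝ × ℝ → ℂ) : ℝ × ℝ → ℂ := fun x =>
  ((2*π)^2 : ℂ)⁻¹ * ∫ ξ : ℝ × ℝ, f ξ * Complex.exp (-(Complex.I) * ((ξ.1*x.1 + ξ.2*x.2 : ℝ) : ℂ))

/-- Rotation matrix `R_γ` acting on `ℝ²`. -/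
def rotM (γ : ℝ) (x : ℝ × ℝ) : ℝ × ℝ :=
  (Real.cos γ * x.1 - Real.sin γ * x.2, Real.sin γ * x.1 + Real.cos γ * x.2)

/-- Transposed rotation matrix `R_γᵀ` acting on `ℝ²`. -/
def rotT (γ : ℝ) (x : ℝ × ℝ) : ℝ × ℝ :=
  (Real.cos γ * x.1 + Real.sin γ * x.2, -(Real.sin γ) * x.1 + Real.cos γ * x.2)

/-- The standard edge fragment `ℰ_j(x) = f(x) φ(2^{j/2}x) χ_{{x₁ ≥ E(x₂)}}(x)`. -/
def edgeFragment (f φ : ℝ × ℝ → ℝ) (E : ℝ → ℝ) (j : ℕ) : ℝ × ℝ → ℝ := fun x =>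
  f x * φ ((2:ℝ)^((j:ℝ)/2) * x.1, (2:ℝ)^((j:ℝ)/2) * x.2) * (if E x.2 ≤ x.1 then 1 else 0)

/-- The second-order differential operator `L = I + 2^j Δ`. -/
def Lop (j : ℕ) (f : ℝ × ℝ → ℂ) : ℝ × ℝ → ℂ := fun x =>
  f x + (Complex.ofReal ((2:ℝ)^(j:ℝ))) * (pd (2,0) f x + pd (0,2) f x)

/-- The dyadic square `Q` indexed by `(n₁,n₂)` at scale `j`. -/
def dyadicSquare (j : ℕ) (n : ℕ × ℕ) : Set (ℝ × ℝ) :=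
  Ico (2*π*(n.1:ℝ)*(2:ℝ)^(-(j:ℝ)/2) - π) (2*π*((n.1:ℝ)+1)*(2:ℝ)^(-(j:ℝ)/2) - π) ×ˢ
  Ico (2*π*(n.2:ℝ)*(2:ℝ)^(-(j:ℝ)/2) - π) (2*π*((n.2:ℝ)+1)*(2:ℝ)^(-(j:ℝ)/2) - π)

/-- The indices of the dyadic squares at scale `j` meeting `∂T` (the set `𝒬_j^1`). -/
def Q1set (T : Set (ℝ × ℝ)) (j : ℕ) : Finset (ℕ × ℕ) :=
  (Finset.range (2^(j/2)) ×ˢ Finset.range (2^(j/2))).filter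
    (fun n => (frontier T ∩ dyadicSquare j n).Nonempty)

/-- Fresnel integral `Fc(x) = ∫₀ˣ cos v/√v dv`. -/
def Fc (x : ℝ) : ℝ := ∫ v in (0:ℝ)..x, Real.cos v / Real.sqrt v

/-- Fresnel integral `Fs(x) = ∫₀ˣ sin v/√v dv`. -/
def Fs (x : ℝ) : ℝ := ∫ v in (0:ℝ)..x, Real.sin v / Real.sqrt v

/-- `F⁺ = Fc + Fs`. -/
def Fp (x : ℝ) : ℝ := Fc x + Fs x

/-- `F⁻ = Fc - Fs`. -/
def Fm (x : ℝ) : ℝ := Fc x - Fs x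

/-- `a(λ,p,A)` of the paper. -/
def aInt (g : ℝ → ℝ) (l p A : ℝ) : ℝ :=
  ∫ v in Ioi (0:ℝ),
    (g (2*Real.sqrt (A*l*v) + p*l) + g (2*Real.sqrt (A*l*v) - p*l)) * (Real.cos v / Real.sqrt v)

/-- `b(λ,p,A)` of the paper. -/
def bInt (g : ℝ → ℝ) (l p A : ℝ) : ℝ :=
  ∫ v in Ioi (0:ℝ),
    (g (2*Real.sqrt (A*l*v) + p*l) + g (2*Real.sqrt (A*l*v) - p*l)) * (Real.sin v / Real.sqrt v)

/-- `P₁(D,p,A)` of the paper. -/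
def P1 (g : ℝ → ℝ) (D p A : ℝ) : ℝ :=
  ∫ l in (1/3 : ℝ)..(4/3),
    gtilde g l * l⁻¹ *
      ((aInt g l p A + bInt g l p A) * Real.cos (D*l)
        + (aInt g l p A - bInt g l p A) * Real.sin (D*l))

/-- `P₂(D,p,A)` of the paper. -/
def P2 (g : ℝ → ℝ) (D p A : ℝ) : ℝ :=
  ∫ l in (1/3 : ℝ)..(4/3),
    gtilde g l * l⁻¹ *
      ((aInt g l p A + bInt g l p A) * Real.sin (D*l)
        - (aInt g l p A - bInt g l p A) * Real.cos (D*l))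


/-- The Taylor polynomial of `cos` of degree `2 * n - 2`. -/
def cosTaylor (n : ℕ) (x : ℝ) : ℝ :=
  ∑ i ∈ Finset.range n, (-1) ^ i * (x ^ (2 * i) / (2 * i).factorial)

/-- The Taylor polynomial of `sin` of degree `2 * n - 1`. -/
def sinTaylor (n : ℕ) (x : ℝ) : ℝ :=
  ∑ i ∈ Finset.range n, (-1) ^ i * (x ^ (2 * i + 1) / (2 * i + 1).factorial)

/-- The primitive of `(cosTaylor n x + sinTaylor n x) / √x` vanishing at `0`. -/
def fresnelTaylor (n : ℕ) (x : ℝ) : ℝ :=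
  ∑ i ∈ Finset.range n, (-1) ^ i *
    (2 * √x * x ^ (2 * i) / (4 * i + 1) / (2 * i).factorial +
      2 * √x * x ^ (2 * i + 1) / (4 * i + 3) / (2 * i + 1).factorial)

lemma hasDerivAt_pow_succ_div_factorial (n : ℕ) (x : ℝ) :
    HasDerivAt (fun y : ℝ => y ^ (n + 1) / (n + 1).factorial) (x ^ n / n.factorial) x := by
  refine ((hasDerivAt_pow (n + 1) x).div_const ((n + 1).factorial : ℝ)).congr_deriv ?_
  have : (n.factorial : ℝ) ≠ 0 := by positivity
  rw [Nat.factorial_succ]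
  push_cast
  field_simp

lemma hasDerivAt_sinTaylor (n : ℕ) (x : ℝ) :
    HasDerivAt (sinTaylor n) (cosTaylor n x) x :=
  HasDerivAt.fun_sum fun i _ => (hasDerivAt_pow_succ_div_factorial (2 * i) x).const_mul ((-1) ^ i)

lemma hasDerivAt_cosTaylor_succ (n : ℕ) (x : ℝ) :
    HasDerivAt (cosTaylor (n + 1)) (-sinTaylor n x) x := by
  have h : cosTaylor (n + 1) = fun y => (∑ i ∈ Finset.range n,
      (-1 : ℝ) ^ (i + 1) * (y ^ (2 * i + 1 + 1) / (2 * i + 1 + 1).factorial)) + 1 := by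
    funext y
    simp [cosTaylor, Finset.sum_range_succ', mul_add]
  rw [h, sinTaylor, ← Finset.sum_neg_distrib]
  refine (HasDerivAt.fun_sum fun i _ => ?_).add_const 1
  refine ((hasDerivAt_pow_succ_div_factorial (2 * i + 1) x).const_mul
    ((-1 : ℝ) ^ (i + 1))).congr_deriv ?_
  ring

/-- A function vanishing at `0` with nonnegative derivative on `(0, ∞)` is nonnegative there. -/
lemma nonneg_of_hasDerivAt_nonneg {f f' : ℝ → ℝ} (hc : ContinuousOn f (Ici 0)) (h0 : f 0 = 0)
    (hd : ∀ x, 0 < x → HasDerivAt f (f' x) x) (hf' : ∀ x, 0 < x → 0 ≤ f' x) {x : ℝ}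
    (hx : 0 ≤ x) : 0 ≤ f x := by
  have hm : MonotoneOn f (Ici 0) := by
    refine monotoneOn_of_hasDerivWithinAt_nonneg (f' := f') (convex_Ici 0) hc ?_ ?_ <;>
      rw [interior_Ici]
    · exact fun y hy => (hd y hy).hasDerivWithinAt
    · exact hf'
  simpa [h0] using hm (mem_Ici.2 le_rfl) (mem_Ici.2 hx) hx

/-- The signs of the remainders of the alternating Taylor expansions of `cos` and `sin`. -/
lemma taylor_remainder_nonneg (n : ℕ) : ∀ x : ℝ, 0 ≤ x →
    0 ≤ (-1) ^ (n + 1) * (cos x - cosTaylor (n + 1) x) ∧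
      0 ≤ (-1) ^ (n + 1) * (sin x - sinTaylor (n + 1) x) := by
  have step (n : ℕ) (hcos : ∀ x : ℝ, 0 ≤ x → 0 ≤ (-1) ^ n * (cos x - cosTaylor n x)) :
      ∀ x : ℝ, 0 ≤ x → 0 ≤ (-1) ^ n * (sin x - sinTaylor n x) := by
    intro x hx
    have hd (y : ℝ) := ((hasDerivAt_sin y).sub (hasDerivAt_sinTaylor n y)).const_mul ((-1 : ℝ) ^ n)
    exact nonneg_of_hasDerivAt_nonneg (f := fun y => (-1) ^ n * (sin y - sinTaylor n y))
      (fun y _ => (hd y).continuousAt.continuousWithinAt) (by simp [sinTaylor])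
      (fun y _ => hd y) (fun y hy => hcos y hy.le) hx
  induction n with
  | zero =>
    have h : ∀ x : ℝ, 0 ≤ x → 0 ≤ (-1) ^ (0 + 1) * (cos x - cosTaylor (0 + 1) x) := by
      intro x _
      simpa [cosTaylor] using cos_le_one x
    exact fun x hx => ⟨h x hx, step _ h x hx⟩
  | succ n ih =>
    have h : ∀ x : ℝ, 0 ≤ x → 0 ≤ (-1) ^ (n + 1 + 1) * (cos x - cosTaylor (n + 1 + 1) x) := by
      intro x hx
      have hd (y : ℝ) := ((hasDerivAt_cos y).sub
        (hasDerivAt_cosTaylor_succ (n + 1) y)).const_mul ((-1 : ℝ) ^ (n + 1 + 1))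
      refine nonneg_of_hasDerivAt_nonneg
        (f := fun y => (-1) ^ (n + 1 + 1) * (cos y - cosTaylor (n + 1 + 1) y))
        (fun y _ => (hd y).continuousAt.continuousWithinAt) ?_
        (fun y _ => hd y) (fun y hy => ?_) hx
      · simp [cosTaylor, Finset.sum_range_succ']
      · have := (ih y hy.le).2
        rw [pow_succ]
        linarith
    exact fun x hx => ⟨h x hx, step _ h x hx⟩

lemma inv_sqrt_eq_rpow (x : ℝ) : (√x)⁻¹ = x ^ (-(1 / 2) : ℝ) := by
  rcases lt_trichotomy x 0 with hx | rfl | hx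
  · rw [sqrt_eq_zero_of_nonpos hx.le, rpow_def_of_neg hx,
      show (-(1 / 2) : ℝ) * π = -(π / 2) by ring]
    simp
  · rw [zero_rpow (by norm_num)]
    simp
  · rw [rpow_neg hx.le, sqrt_eq_rpow]

lemma intervalIntegrable_div_sqrt {f : ℝ → ℝ} (hf : Continuous f) (a b : ℝ) :
    IntervalIntegrable (fun v => f v / √v) volume a b := by
  have h : IntervalIntegrable (fun v : ℝ => v ^ (-(1 / 2) : ℝ)) volume a b :=
    intervalIntegral.intervalIntegrable_rpow' (by norm_num)
  simpa only [div_eq_mul_inv, inv_sqrt_eq_rpow] using h.continuousOn_mul hf.continuousOn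

lemma Fp_eq_integral (x : ℝ) : Fp x = ∫ v in (0 : ℝ)..x, (cos v + sin v) / √v := by
  simp only [add_div]
  exact (intervalIntegral.integral_add (intervalIntegrable_div_sqrt continuous_cos 0 x)
    (intervalIntegrable_div_sqrt continuous_sin 0 x)).symm

lemma continuous_Fp : Continuous Fp := by
  rw [funext Fp_eq_integral]
  exact intervalIntegral.continuous_primitive
    (fun a b => intervalIntegrable_div_sqrt (continuous_cos.add continuous_sin) a b) 0

lemma hasDerivAt_Fp {x : ℝ} (hx : 0 < x) : HasDerivAt Fp ((cos x + sin x) / √x) x := by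
  rw [funext Fp_eq_integral]
  have hc : ContinuousOn (fun v : ℝ => (cos v + sin v) / √v) (Ioi 0) :=
    (continuous_cos.add continuous_sin).continuousOn.div continuous_sqrt.continuousOn
      fun y hy => (sqrt_pos.2 hy).ne'
  exact intervalIntegral.integral_hasDerivAt_right
    (intervalIntegrable_div_sqrt (continuous_cos.add continuous_sin) 0 x)
    (hc.stronglyMeasurableAtFilter isOpen_Ioi x hx) (hc.continuousAt (Ioi_mem_nhds hx))

lemma hasDerivAt_sqrt_mul_pow (k : ℕ) {x : ℝ} (hx : 0 < x) :
    HasDerivAt (fun y : ℝ => 2 * √y * y ^ k / (2 * k + 1)) (x ^ k / √x) x := by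
  refine ((((hasDerivAt_sqrt hx.ne').const_mul 2).mul (hasDerivAt_pow k x)).div_const
    (2 * k + 1 : ℝ)).congr_deriv ?_
  have hs : √x ≠ 0 := (sqrt_pos.2 hx).ne'
  rcases k with _ | k
  · simp
    field_simp
  · push_cast
    field_simp
    rw [sq_sqrt hx.le]
    ring

lemma hasDerivAt_fresnelTaylor (n : ℕ) {x : ℝ} (hx : 0 < x) :
    HasDerivAt (fresnelTaylor n) ((cosTaylor n x + sinTaylor n x) / √x) x := by
  rw [cosTaylor, sinTaylor, ← Finset.sum_add_distrib, Finset.sum_div]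
  refine HasDerivAt.fun_sum fun i _ => ?_
  have h := (((hasDerivAt_sqrt_mul_pow (2 * i) hx).div_const ((2 * i).factorial : ℝ)).add
    ((hasDerivAt_sqrt_mul_pow (2 * i + 1) hx).div_const
      ((2 * i + 1).factorial : ℝ))).const_mul ((-1 : ℝ) ^ i)
  refine (h.congr_deriv (by ring)).congr_of_eventuallyEq (.of_forall fun y => ?_)
  simp only [Pi.add_apply]
  push_cast
  ring

lemma continuous_fresnelTaylor (n : ℕ) : Continuous (fresnelTaylor n) := by
  unfold fresnelTaylor
  fun_prop

/-- The remainder of the alternating expansion of `Fp` has the sign of the first omitted term. -/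
lemma Fp_remainder_nonneg (n : ℕ) {x : ℝ} (hx : 0 ≤ x) :
    0 ≤ (-1) ^ (n + 1) * (Fp x - fresnelTaylor (n + 1) x) := by
  refine nonneg_of_hasDerivAt_nonneg
    (f := fun y => (-1) ^ (n + 1) * (Fp y - fresnelTaylor (n + 1) y))
    (f' := fun y => (-1) ^ (n + 1) *
      ((cos y + sin y) / √y - (cosTaylor (n + 1) y + sinTaylor (n + 1) y) / √y))
    (continuous_const.mul (continuous_Fp.sub (continuous_fresnelTaylor _))).continuousOn ?_
    (fun y hy => ((hasDerivAt_Fp hy).sub (hasDerivAt_fresnelTaylor _ hy)).const_mul _)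
    (fun y hy => ?_) hx
  · simp [fresnelTaylor, Fp, Fc, Fs]
  · obtain ⟨h₁, h₂⟩ := taylor_remainder_nonneg n y hy.le
    rw [← sub_div, mul_div_assoc']
    exact div_nonneg (by linarith) (sqrt_nonneg y)

lemma abs_Fp_sub_le {x y : ℝ} (hx : 1 ≤ x) (hy : 1 ≤ y) : |Fp x - Fp y| ≤ 2 * |x - y| := by
  refine (convex_Ici (1 : ℝ)).norm_image_sub_le_of_norm_hasDerivWithin_le
    (f' := fun z => (cos z + sin z) / √z)
    (fun z hz => (hasDerivAt_Fp (zero_lt_one.trans_le hz)).hasDerivWithinAt)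
    (fun z hz => ?_) hy hx
  have hs : 1 ≤ √z := one_le_sqrt.2 hz
  rw [norm_eq_abs, abs_div, abs_of_nonneg (sqrt_nonneg z), div_le_iff₀ (by linarith)]
  linarith [abs_add_le (cos z) (sin z), abs_cos_le_one z, abs_sin_le_one z]

lemma Fp_three_pi_div_four_lt : Fp (3 * π / 4) < 3.37 := by
  have h := Fp_remainder_nonneg 4 (x := 1.535 ^ 2) (by norm_num)
  have h' := abs_Fp_sub_le (x := 3 * π / 4) (y := 1.535 ^ 2)
    (by linarith [pi_gt_three]) (by norm_num)
  have hd : |3 * π / 4 - 1.535 ^ 2| ≤ 0.001 := by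
    rw [abs_le]
    constructor <;> linarith [pi_gt_d6, pi_lt_d6]
  have hv : fresnelTaylor 5 (1.535 ^ 2) < 3.362 := by
    rw [fresnelTaylor, sqrt_sq (by norm_num)]
    norm_num [Finset.sum_range_succ, Nat.factorial]
  norm_num only at h hv h' hd ⊢
  linarith [(abs_le.1 h').2]

lemma lt_Fp_seven_pi_div_four : 1.91 < Fp (7 * π / 4) := by
  have h := Fp_remainder_nonneg 9 (x := 2.3448 ^ 2) (by norm_num)
  have h' := abs_Fp_sub_le (x := 7 * π / 4) (y := 2.3448 ^ 2)
    (by linarith [pi_gt_three]) (by norm_num)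
  have hd : |7 * π / 4 - 2.3448 ^ 2| ≤ 0.001 := by
    rw [abs_le]
    constructor <;> linarith [pi_gt_d6, pi_lt_d6]
  have hv : 1.914 < fresnelTaylor 10 (2.3448 ^ 2) := by
    rw [fresnelTaylor, sqrt_sq (by norm_num)]
    norm_num [Finset.sum_range_succ, Nat.factorial]
  norm_num only at h hv h' hd ⊢
  linarith [(abs_le.1 h').1]

lemma cos_add_sin_eq (x : ℝ) : cos x + sin x = √2 * sin (x + π / 4) := by
  rw [sin_add, cos_pi_div_four, sin_pi_div_four]
  linear_combination (-(sin x + cos x) / 2) * sq_sqrt (zero_le_two (α := ℝ))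

lemma abs_sin_sub_cos_le (x : ℝ) : |sin x - cos x| ≤ √2 := by
  refine abs_le_sqrt ?_
  nlinarith [sin_sq_add_cos_sq x, sq_nonneg (sin x + cos x)]

lemma monotoneOn_Fp : MonotoneOn Fp (Icc 0 (3 * π / 4)) := by
  refine monotoneOn_of_hasDerivWithinAt_nonneg (convex_Icc _ _) continuous_Fp.continuousOn
    (f' := fun x => (cos x + sin x) / √x) ?_ ?_ <;> rw [interior_Icc]
  · exact fun x hx => (hasDerivAt_Fp hx.1).hasDerivWithinAt
  · intro x hx
    rw [cos_add_sin_eq]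
    exact div_nonneg (mul_nonneg (sqrt_nonneg 2) (sin_nonneg_of_nonneg_of_le_pi
      (by linarith [hx.1, pi_pos]) (by linarith [hx.2]))) (sqrt_nonneg x)

lemma antitoneOn_Fp : AntitoneOn Fp (Icc (3 * π / 4) (7 * π / 4)) := by
  refine antitoneOn_of_hasDerivWithinAt_nonpos (convex_Icc _ _) continuous_Fp.continuousOn
    (f' := fun x => (cos x + sin x) / √x) ?_ ?_ <;> rw [interior_Icc]
  · exact fun x hx => (hasDerivAt_Fp (by linarith [hx.1, pi_pos])).hasDerivWithinAt
  · intro x hx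
    have h : sin (x + π / 4) ≤ 0 := by
      rw [← neg_nonneg, ← sin_sub_pi]
      exact sin_nonneg_of_nonneg_of_le_pi (by linarith [hx.1]) (by linarith [hx.2])
    rw [cos_add_sin_eq]
    exact div_nonpos_of_nonpos_of_nonneg
      (mul_nonpos_of_nonneg_of_nonpos (sqrt_nonneg 2) h) (sqrt_nonneg x)

/-- The derivative obtained from integrating `Fp` by parts. -/
lemma hasDerivAt_Fp_sub_div_sqrt (c : ℝ) {x : ℝ} (hx : 0 < x) :
    HasDerivAt (fun y => Fp y - (sin y - cos y + c) / √y)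
      ((sin x - cos x + c) / (2 * x * √x)) x := by
  have hs : √x ≠ 0 := (sqrt_pos.2 hx).ne'
  refine ((hasDerivAt_Fp hx).sub ((((hasDerivAt_sin x).sub (hasDerivAt_cos x)).add_const c).div
    (hasDerivAt_sqrt hx.ne') hs)).congr_deriv ?_
  simp only [Pi.sub_apply, sq_sqrt hx.le]
  field_simp
  rw [sq_sqrt hx.le]
  ring

lemma sin_sub_cos_three_pi_div_four : sin (3 * π / 4) - cos (3 * π / 4) = √2 := by
  rw [show 3 * π / 4 = π - π / 4 by ring, sin_pi_sub, cos_pi_sub, sin_pi_div_four,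
    cos_pi_div_four]
  ring

lemma sin_sub_cos_seven_pi_div_four : sin (7 * π / 4) - cos (7 * π / 4) = -√2 := by
  rw [show 7 * π / 4 = 2 * π - π / 4 by ring, sin_two_pi_sub, cos_two_pi_sub, sin_pi_div_four,
    cos_pi_div_four]
  ring

lemma Fp_le_three_pi_div_four {x : ℝ} (hx : 3 * π / 4 ≤ x) : Fp x ≤ Fp (3 * π / 4) := by
  have hpos {y : ℝ} (hy : 3 * π / 4 ≤ y) : 0 < y := by linarith [pi_pos]
  have hm : AntitoneOn (fun y => Fp y - (sin y - cos y + -√2) / √y) (Ici (3 * π / 4)) := by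
    refine antitoneOn_of_hasDerivWithinAt_nonpos (convex_Ici _)
      (fun y hy => (hasDerivAt_Fp_sub_div_sqrt _ (hpos hy)).continuousAt.continuousWithinAt)
      (fun y hy => (hasDerivAt_Fp_sub_div_sqrt _
        (hpos (interior_subset hy))).hasDerivWithinAt) (fun y hy => ?_)
    have := hpos (interior_subset hy)
    exact div_nonpos_of_nonpos_of_nonneg (by linarith [(abs_le.1 (abs_sin_sub_cos_le y)).2])
      (by positivity)
  have h := hm (mem_Ici.2 le_rfl) (mem_Ici.2 hx) hx
  have hK : (sin x - cos x + -√2) / √x ≤ 0 := div_nonpos_of_nonpos_of_nonneg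
    (by linarith [(abs_le.1 (abs_sin_sub_cos_le x)).2]) (sqrt_nonneg x)
  simp only [sin_sub_cos_three_pi_div_four, add_neg_cancel, zero_div, sub_zero] at h
  linarith

lemma Fp_seven_pi_div_four_le {x : ℝ} (hx : 7 * π / 4 ≤ x) : Fp (7 * π / 4) ≤ Fp x := by
  have hpos {y : ℝ} (hy : 7 * π / 4 ≤ y) : 0 < y := by linarith [pi_pos]
  have hm : MonotoneOn (fun y => Fp y - (sin y - cos y + √2) / √y) (Ici (7 * π / 4)) := by
    refine monotoneOn_of_hasDerivWithinAt_nonneg (convex_Ici _)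
      (fun y hy => (hasDerivAt_Fp_sub_div_sqrt _ (hpos hy)).continuousAt.continuousWithinAt)
      (fun y hy => (hasDerivAt_Fp_sub_div_sqrt _
        (hpos (interior_subset hy))).hasDerivWithinAt) (fun y hy => ?_)
    have := hpos (interior_subset hy)
    exact div_nonneg (by linarith [(abs_le.1 (abs_sin_sub_cos_le y)).1]) (by positivity)
  have h := hm (mem_Ici.2 le_rfl) (mem_Ici.2 hx) hx
  have hK : 0 ≤ (sin x - cos x + √2) / √x := div_nonneg
    (by linarith [(abs_le.1 (abs_sin_sub_cos_le x)).1]) (sqrt_nonneg x)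
  simp only [sin_sub_cos_seven_pi_div_four, neg_add_cancel, zero_div, sub_zero] at h
  linarith

/-- Bounds and extremal points of `F⁺ = Fc + Fs`:
`1.91 < F⁺(x) < 3.37` for `x ≥ 3π/4`, `0 ≤ F⁺(x) < 3.37` for `0 ≤ x < 3π/4`,
`3π/4` is the global maximum point of `F⁺` on `(0,∞)` and `7π/4` its smallest
local minimum, i.e. `F⁺(x) ≤ F⁺(3π/4)` for all `x > 0` and `F⁺(x) ≥ F⁺(7π/4)`
for all `x ≥ 3π/4`. -/
theorem Fp_bounds :
    (∀ x : ℝ, 3*π/4 ≤ x → 1.91 < Fp x ∧ Fp x < 3.37) ∧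
    (∀ x : ℝ, 0 ≤ x → x < 3*π/4 → 0 ≤ Fp x ∧ Fp x < 3.37) ∧
    (∀ x : ℝ, 0 < x → Fp x ≤ Fp (3*π/4)) ∧
    (∀ x : ℝ, 3*π/4 ≤ x → Fp (7*π/4) ≤ Fp x) := by
  have hpi := pi_pos
  have hmax : ∀ x : ℝ, 0 ≤ x → Fp x ≤ Fp (3*π/4) := by
    intro x hx
    rcases le_total x (3*π/4) with h | h
    · exact monotoneOn_Fp ⟨hx, h⟩ ⟨by positivity, le_rfl⟩ h
    · exact Fp_le_three_pi_div_four h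
  have hmin : ∀ x : ℝ, 3*π/4 ≤ x → Fp (7*π/4) ≤ Fp x := by
    intro x hx
    rcases le_total x (7*π/4) with h | h
    · exact antitoneOn_Fp ⟨hx, h⟩ ⟨by linarith, le_rfl⟩ h
    · exact Fp_seven_pi_div_four_le h
  refine ⟨fun x hx => ⟨lt_Fp_seven_pi_div_four.trans_le (hmin x hx),
    (hmax x (by linarith)).trans_lt Fp_three_pi_div_four_lt⟩,
    fun x hx hx' => ⟨?_, (hmax x hx).trans_lt Fp_three_pi_div_four_lt⟩,
    fun x hx => hmax x hx.le, hmin⟩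
  have h := monotoneOn_Fp ⟨le_rfl, by positivity⟩ ⟨hx, hx'.le⟩ hx
  simpa [Fp, Fc, Fs] using h
end
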